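/- Let p be a prime number, d an integer, and C a bounded cochain complex of finitely generated free modules over the ring ℤ_p of p-adic integers. Assume that H^q(C ⊗_{ℤ_p} ℚ_p) = 0 for all q ≠ d and H^q(C ⊗_{ℤ_p} 𝔽_p) = 0 for all q ≠ d. Then for every integer q, the natural map H^q(C) ⊗_{ℤ_p} 𝔽_p → H^q(C ⊗_{ℤ_p} 𝔽_p) is an isomorphism. -/

import Mathlib

open TensorProduct

noncomputable section

/-- Transport of a term of a `ℤ`-indexed family of modules along an equality of indices. -/
def lcast {R : Type} [Semiring R] (X : ℤ → Type) [∀ q, AddCommGroup (X q)]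
    [∀ q, Module R (X q)] {i j : ℤ} (h : i = j) : X i ≃ₗ[R] X j := by
  subst h; exact LinearEquiv.refl R (X i)

/-- Cohomology in degree `q` of a `ℤ`-indexed cochain complex `(X, δ)` of `R`-modules:
the kernel of `δ q` modulo the image of `δ (q - 1)`. -/
abbrev cohomology {R : Type} [CommRing R] (X : ℤ → Type) [∀ q, AddCommGroup (X q)]
    [∀ q, Module R (X q)] (δ : ∀ q : ℤ, X q →ₗ[R] X (q + 1)) (q : ℤ) : Type :=
  ↥(LinearMap.ker (δ q)) ⧸
    (LinearMap.range ((lcast X (show q - 1 + 1 = q by omega)).toLinearMap ∘ₗ δ (q - 1))).comap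
      (LinearMap.ker (δ q)).subtype

/-- `𝔽_p = ℤ/pℤ` is a `ℤ_[p]`-algebra via reduction mod `p`. -/
local instance (p : ℕ) [Fact p.Prime] : Algebra ℤ_[p] (ZMod p) :=
  (PadicInt.toZMod).toAlgebra

section NaturalMap

variable {R S : Type} [CommRing R] [CommRing S] [Algebra R S]
variable (X : ℤ → Type) [∀ q, AddCommGroup (X q)] [∀ q, Module R (X q)]
variable (δ : ∀ q : ℤ, X q →ₗ[R] X (q + 1))

lemma lcast_one_tmul {i j : ℤ} (h : i = j) (z : X i) :
    (1 : S) ⊗ₜ[R] ((lcast (R := R) X h).toLinearMap z) =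
      (lcast (R := S) (fun n => S ⊗[R] X n) h).toLinearMap ((1 : S) ⊗ₜ[R] z) := by
  subst h; rfl

/-- The map sending a cocycle `x` of `(X, δ)` to the class of the cocycle `1 ⊗ x` of the
base-changed complex. -/
def cocycleToBaseChange (q : ℤ) :
    ↥(LinearMap.ker (δ q)) →ₗ[R]
      cohomology (R := S) (fun n => S ⊗[R] X n) (fun n => (δ n).baseChange S) q where
  toFun c := Submodule.Quotient.mk
    ⟨(1 : S) ⊗ₜ[R] (c : X q), by
      simp only [LinearMap.mem_ker, LinearMap.baseChange_tmul,
        LinearMap.mem_ker.mp c.2, TensorProduct.tmul_zero]⟩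
  map_add' a b := by
    dsimp only
    rw [← Submodule.Quotient.mk_add]
    exact congrArg _ (Subtype.ext (by simp [TensorProduct.tmul_add]))
  map_smul' r c := by
    dsimp only [RingHom.id_apply]
    rw [← Submodule.Quotient.mk_smul]
    exact congrArg _ (Subtype.ext (by simp [TensorProduct.tmul_smul]))

end NaturalMap

section NaturalMap2

variable {R S : Type} [CommRing R] [CommRing S] [Algebra R S]
variable (X : ℤ → Type) [∀ q, AddCommGroup (X q)] [∀ q, Module R (X q)]
variable (δ : ∀ q : ℤ, X q →ₗ[R] X (q + 1))

/-- The map `H^q(C) → H^q(C ⊗ S)` induced by `x ↦ 1 ⊗ x` on cocycles. -/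
def cohomologyToBaseChange (q : ℤ) :
    cohomology X δ q →ₗ[R]
      cohomology (R := S) (fun n => S ⊗[R] X n) (fun n => (δ n).baseChange S) q :=
  Submodule.liftQ _ (cocycleToBaseChange X δ q) (by
    rintro ⟨x, hx⟩ ⟨y, hy⟩
    rw [LinearMap.mem_ker]
    change Submodule.Quotient.mk _ = 0
    rw [Submodule.Quotient.mk_eq_zero]
    refine ⟨(1 : S) ⊗ₜ[R] y, ?_⟩
    show (lcast (R := S) (fun n => S ⊗[R] X n) _).toLinearMap
        (((δ (q - 1)).baseChange S) ((1 : S) ⊗ₜ[R] y)) = (1 : S) ⊗ₜ[R] x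
    rw [LinearMap.baseChange_tmul, ← lcast_one_tmul]
    exact congrArg (fun z => (1 : S) ⊗ₜ[R] z) hy)

/-- The natural base-change map `S ⊗_R H^q(C) → H^q(C ⊗_R S)`. -/
def baseChangeCohomology (q : ℤ) :
    S ⊗[R] cohomology X δ q →ₗ[S]
      cohomology (R := S) (fun n => S ⊗[R] X n) (fun n => (δ n).baseChange S) q :=
  LinearMap.liftBaseChange S (cohomologyToBaseChange X δ q)

end NaturalMap2

section MulKernel

variable {R S : Type} [CommRing R] [CommRing S] [Algebra R S]

lemma exists_one_tmul_eq (hsurj : Function.Surjective (algebraMap R S))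
    {M : Type} [AddCommGroup M] [Module R M] (t : S ⊗[R] M) :
    ∃ m : M, (1 : S) ⊗ₜ[R] m = t := by
  induction t with
  | zero => exact ⟨0, TensorProduct.tmul_zero _ _⟩
  | tmul s m =>
    obtain ⟨r, rfl⟩ := hsurj s
    exact ⟨r • m, by rw [TensorProduct.tmul_smul, TensorProduct.smul_tmul',
      Algebra.algebraMap_eq_smul_one]⟩
  | add a b ha hb =>
    obtain ⟨m, rfl⟩ := ha
    obtain ⟨n, rfl⟩ := hb
    exact ⟨m + n, TensorProduct.tmul_add _ _ _⟩

variable {π : R}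

lemma one_tmul_smul_eq_zero (hπ : ∀ r : R, algebraMap R S r = 0 ↔ π ∣ r)
    {M : Type} [AddCommGroup M] [Module R M] (m : M) :
    (1 : S) ⊗ₜ[R] (π • m) = 0 := by
  rw [TensorProduct.tmul_smul, TensorProduct.smul_tmul', ← Algebra.algebraMap_eq_smul_one,
    (hπ π).2 dvd_rfl, TensorProduct.zero_tmul]

lemma exists_smul_eq_of_one_tmul_eq_zero (hsurj : Function.Surjective (algebraMap R S))
    (hπ : ∀ r : R, algebraMap R S r = 0 ↔ π ∣ r)
    {M : Type} [AddCommGroup M] [Module R M] {m : M} (hm : (1 : S) ⊗ₜ[R] m = 0) :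
    ∃ n : M, m = π • n := by
  have hex : Function.Exact (LinearMap.lsmul R R π) (Algebra.linearMap R S) := by
    intro r
    rw [Algebra.linearMap_apply, hπ]
    exact ⟨fun ⟨s, hs⟩ => ⟨s, hs.symm⟩, fun ⟨s, hs⟩ => ⟨s, hs.symm⟩⟩
  obtain ⟨t, ht⟩ := (rTensor_exact M hex hsurj ((1 : R) ⊗ₜ[R] m)).1 (by simpa using hm)
  refine ⟨TensorProduct.lid R M t, ?_⟩
  have hlid : ∀ t : R ⊗[R] M, TensorProduct.lid R M ((LinearMap.lsmul R R π).rTensor M t) =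
      π • TensorProduct.lid R M t := by
    intro t
    induction t with
    | zero => simp
    | tmul r n => simp [mul_smul]
    | add a b ha hb => simp only [map_add, ha, hb, smul_add]
  rw [← hlid, ht, TensorProduct.lid_tmul, one_smul]

variable (X : ℤ → Type) [∀ q, AddCommGroup (X q)] [∀ q, Module R (X q)]
variable (δ : ∀ q : ℤ, X q →ₗ[R] X (q + 1))

lemma lcast_map {i j : ℤ} (h : i = j) (h' : i + 1 = j + 1) (x : X i) :
    lcast (R := R) X h' (δ i x) = δ j (lcast (R := R) X h x) := by
  subst h; rfl

lemma exists_map_eq_of_subsingleton_cohomology {q : ℤ}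
    (h : Subsingleton (cohomology X δ (q + 1))) {y : X (q + 1)} (hy : δ (q + 1) y = 0) :
    ∃ w : X q, δ q w = y := by
  have h0 : (Submodule.Quotient.mk ⟨y, hy⟩ : cohomology X δ (q + 1)) = 0 := Subsingleton.elim _ _
  rw [Submodule.Quotient.mk_eq_zero] at h0
  obtain ⟨w, hw⟩ := h0
  exact ⟨lcast X (by omega) w, (lcast_map X δ (by omega) (by omega) w).symm.trans hw⟩

lemma baseChangeCohomology_one_tmul_mk (q : ℤ) (c : LinearMap.ker (δ q)) :
    baseChangeCohomology (S := S) X δ q ((1 : S) ⊗ₜ[R] Submodule.Quotient.mk c) =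
      cocycleToBaseChange X δ q c := by
  simp only [baseChangeCohomology, LinearMap.liftBaseChange_tmul, one_smul]
  rfl

lemma baseChangeCohomology_injective (hsurj : Function.Surjective (algebraMap R S))
    (hπ : ∀ r : R, algebraMap R S r = 0 ↔ π ∣ r)
    (hreg : ∀ q, IsSMulRegular (X q) π) (hδδ : ∀ (q : ℤ) (x : X q), δ (q + 1) (δ q x) = 0)
    (q : ℤ) : Function.Injective (baseChangeCohomology (S := S) X δ q) := by
  rw [injective_iff_map_eq_zero]
  intro t ht
  obtain ⟨h, rfl⟩ := exists_one_tmul_eq hsurj t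
  obtain ⟨⟨x, hx⟩, rfl⟩ := Submodule.Quotient.mk_surjective _ h
  rw [baseChangeCohomology_one_tmul_mk] at ht
  obtain ⟨u, hu⟩ := (Submodule.Quotient.mk_eq_zero _).1 ht
  obtain ⟨y, rfl⟩ := exists_one_tmul_eq hsurj u
  replace hu : (1 : S) ⊗ₜ[R] (lcast (R := R) X (show q - 1 + 1 = q by omega)).toLinearMap
      (δ (q - 1) y) = (1 : S) ⊗ₜ[R] x := by
    rw [lcast_one_tmul]; exact hu
  set b := (lcast (R := R) X (show q - 1 + 1 = q by omega)).toLinearMap (δ (q - 1) y) with hb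
  obtain ⟨z, hz⟩ := exists_smul_eq_of_one_tmul_eq_zero (S := S) hsurj hπ (m := x - b)
    (by rw [TensorProduct.tmul_sub, hu, sub_self])
  have hδb : δ q b = 0 :=
    (lcast_map X δ (show q - 1 + 1 = q by omega) (by omega) (δ (q - 1) y)).symm.trans
      (by rw [hδδ, map_zero])
  have hδz : δ q z = 0 := hreg (q + 1) <| by
    change π • δ q z = π • (0 : X (q + 1))
    rw [← map_smul, ← hz, map_sub, hδb, LinearMap.mem_ker.1 hx, sub_zero, smul_zero]
  have hxz : (Submodule.Quotient.mk ⟨x, hx⟩ : cohomology X δ q) =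
      π • Submodule.Quotient.mk ⟨z, hδz⟩ := by
    rw [← Submodule.Quotient.mk_smul, Submodule.Quotient.eq]
    exact ⟨y, hb.symm.trans (show b = x - π • z by rw [← hz, sub_sub_cancel])⟩
  rw [hxz, one_tmul_smul_eq_zero hπ]

lemma baseChangeCohomology_surjective (hsurj : Function.Surjective (algebraMap R S))
    (hπ : ∀ r : R, algebraMap R S r = 0 ↔ π ∣ r)
    (hreg : ∀ q, IsSMulRegular (X q) π) (hδδ : ∀ (q : ℤ) (x : X q), δ (q + 1) (δ q x) = 0)
    (q : ℤ) (hq : Subsingleton (cohomology X δ (q + 1))) :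
    Function.Surjective (baseChangeCohomology (S := S) X δ q) := by
  intro t
  obtain ⟨⟨u, hu⟩, rfl⟩ := Submodule.Quotient.mk_surjective _ t
  obtain ⟨x, rfl⟩ := exists_one_tmul_eq hsurj u
  obtain ⟨y, hy⟩ := exists_smul_eq_of_one_tmul_eq_zero (S := S) hsurj hπ (m := δ q x) hu
  have hδy : δ (q + 1) y = 0 := hreg (q + 1 + 1) <| by
    change π • δ (q + 1) y = π • (0 : X (q + 1 + 1))
    rw [← map_smul, ← hy, hδδ, smul_zero]
  obtain ⟨w, rfl⟩ := exists_map_eq_of_subsingleton_cohomology X δ hq hδy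
  have hc : x - π • w ∈ LinearMap.ker (δ q) := by
    rw [LinearMap.mem_ker, map_sub, map_smul, hy, sub_self]
  refine ⟨(1 : S) ⊗ₜ[R] Submodule.Quotient.mk ⟨x - π • w, hc⟩, ?_⟩
  rw [baseChangeCohomology_one_tmul_mk]
  exact congrArg Submodule.Quotient.mk (Subtype.ext
    (show (1 : S) ⊗ₜ[R] (x - π • w) = (1 : S) ⊗ₜ[R] x by
      rw [TensorProduct.tmul_sub, one_tmul_smul_eq_zero hπ, sub_zero]))

lemma subsingleton_of_subsingleton_tensorProduct [IsLocalRing R]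
    (hsurj : Function.Surjective (algebraMap R S))
    (hπ : ∀ r : R, algebraMap R S r = 0 ↔ π ∣ r) (hunit : ¬ IsUnit π)
    {M : Type} [AddCommGroup M] [Module R M] [Module.Finite R M]
    (h : Subsingleton (S ⊗[R] M)) : Subsingleton M := by
  rw [← Submodule.subsingleton_iff R, ← subsingleton_iff_bot_eq_top, eq_comm]
  refine Submodule.eq_bot_of_le_smul_of_le_jacobson_bot (Ideal.span {π}) _
    Module.Finite.fg_top (fun m _ => ?_) ?_
  · obtain ⟨n, rfl⟩ := exists_smul_eq_of_one_tmul_eq_zero (S := S) hsurj hπ (m := m)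
      (Subsingleton.elim _ _)
    exact Submodule.smul_mem_smul (Ideal.mem_span_singleton_self π) trivial
  · rw [IsLocalRing.jacobson_eq_maximalIdeal _ bot_ne_top, Ideal.span_singleton_le_iff_mem]
    exact hunit

end MulKernel

/-- for a bounded cochain complex `(X, δ)` of finitely generated free
`ℤ_p`-modules whose `ℚ_p`- and `𝔽_p`-cohomologies are both concentrated in degree `d`,
the natural base-change map `H^q(C) ⊗ 𝔽_p → H^q(C ⊗ 𝔽_p)` is an isomorphism for all `q`. -/
theorem natural_map_to_mod_p_cohomology_bijective (p : ℕ) [Fact p.Prime] (d : ℤ)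
    (X : ℤ → Type) [∀ q, AddCommGroup (X q)] [∀ q, Module ℤ_[p] (X q)]
    [∀ q, Module.Finite ℤ_[p] (X q)] [∀ q, Module.Free ℤ_[p] (X q)]
    (δ : ∀ q : ℤ, X q →ₗ[ℤ_[p]] X (q + 1))
    (hδδ : ∀ (q : ℤ) (x : X q), δ (q + 1) (δ q x) = 0)
    (hbdd : ∃ N : ℕ, ∀ q : ℤ, (N : ℤ) < |q| → Subsingleton (X q))
    (hQ : ∀ q : ℤ, q ≠ d →
      Subsingleton (cohomology (fun n => ℚ_[p] ⊗[ℤ_[p]] X n)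
        (fun n => (δ n).baseChange ℚ_[p]) q))
    (hF : ∀ q : ℤ, q ≠ d →
      Subsingleton (cohomology (fun n => (ZMod p) ⊗[ℤ_[p]] X n)
        (fun n => (δ n).baseChange (ZMod p)) q)) :
    ∀ q : ℤ, Function.Bijective (baseChangeCohomology (S := ZMod p) X δ q) := by
  have hsurj : Function.Surjective (algebraMap ℤ_[p] (ZMod p)) := ZMod.ringHom_surjective _
  have hπ : ∀ r : ℤ_[p], algebraMap ℤ_[p] (ZMod p) r = 0 ↔ (p : ℤ_[p]) ∣ r := fun r => by
    rw [← Ideal.mem_span_singleton, ← PadicInt.maximalIdeal_eq_span_p, ← PadicInt.ker_toZMod]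
    rfl
  have hreg : ∀ q, IsSMulRegular (X q) (p : ℤ_[p]) := fun q =>
    smul_right_injective (X q) PadicInt.prime_p.ne_zero
  have hinj := baseChangeCohomology_injective X δ hsurj hπ hreg hδδ
  refine fun q => ⟨hinj q, ?_⟩
  by_cases hq : q = d
  · have := hF (q + 1) (by omega)
    exact baseChangeCohomology_surjective X δ hsurj hπ hreg hδδ q
      (subsingleton_of_subsingleton_tensorProduct hsurj hπ PadicInt.prime_p.not_isUnit
        (hinj (q + 1)).subsingleton)
  · have := hF q hq
    exact Function.surjective_to_subsingleton _
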